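/- arXiv:2003.11537 — 2 statements merged into one kernel-verified Lean document; each statement's English description precedes it below -/
import Mathlib

section
/- Let Y and ψ be integrable real random variables with cumulative distribution functions F_Y and F_ψ, and let Δ(y) = ∫_{−∞}^y (F_Y(t) − F_ψ(t)) dt. Then H₀ holds if and only if Δ(y) ≥ 0 for all y ∈ ℝ and E[Y] = E[ψ] (i.e., F_Y is a mean-preserving spread of F_ψ). -/
open MeasureTheory ProbabilityTheory

/-- H₀ realized on a given probability space `(Ω, P)`. -/
def H0On (Ω : Type) [mΩ : MeasurableSpace Ω] (P : Measure Ω) (μY μψ : Measure ℝ) : Prop :=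
  IsProbabilityMeasure P ∧
    ∃ Y' ψ' : Ω → ℝ,
      Measurable Y' ∧ Measurable ψ' ∧
      P.map Y' = μY ∧ P.map ψ' = μψ ∧
      ∃ I' : MeasurableSpace Ω,
        I' ≤ mΩ ∧
        MeasurableSpace.comap ψ' Real.measurableSpace ≤ I' ∧
        P[Y' | I'] =ᵐ[P] ψ'

/-- H₀ (rationalizing rational expectations) for a pair of marginal distributions. -/
def H0 (μY μψ : Measure ℝ) : Prop :=
  ∃ (Ω : Type) (mΩ : MeasurableSpace Ω) (P : @Measure Ω mΩ), @H0On Ω mΩ P μY μψ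

section Auxiliary

open Set Filter
open scoped Topology ENNReal

/-- The uniform distribution on the open unit interval. -/
noncomputable def unitUniform : Measure ℝ := volume.restrict (Ioo 0 1)

instance : IsProbabilityMeasure unitUniform := ⟨by simp [unitUniform]⟩

lemma unitUniform_Iic {x : ℝ} (h0 : 0 ≤ x) (h1 : x ≤ 1) :
    unitUniform (Iic x) = ENNReal.ofReal x := by
  rw [unitUniform, Measure.restrict_apply measurableSet_Iic]
  rcases h1.eq_or_lt with rfl | h1
  · rw [inter_eq_right.2 (fun u hu => hu.2.le)]
    simp
  · have : Iic x ∩ Ioo 0 1 = Ioc 0 x := by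
      ext u
      simp only [mem_inter_iff, mem_Iic, mem_Ioo, mem_Ioc]
      exact ⟨fun h => ⟨h.2.1, h.1⟩, fun h => ⟨h.2, h.1, h.2.trans_lt h1⟩⟩
    rw [this]
    simp

lemma ae_unitUniform_mem : ∀ᵐ u ∂unitUniform, u ∈ Ioo (0 : ℝ) 1 :=
  ae_restrict_mem measurableSet_Ioo

/-- `q` is a (lower) quantile function of `μ`: a measurable generalized inverse of its cdf. -/
def IsQuantile (q : ℝ → ℝ) (μ : Measure ℝ) : Prop :=
  Measurable q ∧ ∀ u ∈ Ioo (0 : ℝ) 1, ∀ x, q u ≤ x ↔ u ≤ cdf μ x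

lemma sInf_le_iff_le_cdf (μ : Measure ℝ) {u : ℝ} (hu : u ∈ Ioo (0 : ℝ) 1) (x : ℝ) :
    sInf {y | u ≤ cdf μ y} ≤ x ↔ u ≤ cdf μ x := by
  obtain ⟨a, ha⟩ := ((tendsto_cdf_atBot μ).eventually (gt_mem_nhds hu.1)).exists
  obtain ⟨b, hb⟩ := ((tendsto_cdf_atTop μ).eventually (lt_mem_nhds hu.2)).exists
  have hbdd : BddBelow {y | u ≤ cdf μ y} := by
    refine ⟨a, fun y hy => ?_⟩
    by_contra! hlt
    exact absurd (monotone_cdf μ hlt.le) (not_le.2 (ha.trans_le hy))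
  have hne : {y | u ≤ cdf μ y}.Nonempty := ⟨b, hb.le⟩
  refine ⟨fun h => ?_, fun h => csInf_le hbdd h⟩
  have hright : Tendsto (cdf μ) (𝓝[>] x) (𝓝 (cdf μ x)) :=
    ((cdf μ).right_continuous x).mono_left (nhdsWithin_mono _ Ioi_subset_Ici_self)
  refine ge_of_tendsto hright ?_
  filter_upwards [self_mem_nhdsWithin] with y hy
  obtain ⟨z, hz, hzy⟩ := exists_lt_of_csInf_lt hne (h.trans_lt hy)
  exact le_trans hz (monotone_cdf μ hzy.le)

lemma exists_isQuantile (μ : Measure ℝ) : ∃ q, IsQuantile q μ := by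
  refine ⟨(Ioo (0 : ℝ) 1).indicator fun u => sInf {y | u ≤ cdf μ y}, ?_, fun u hu x => ?_⟩
  · refine measurable_of_Iic fun x => ?_
    have : ((Ioo (0 : ℝ) 1).indicator fun u => sInf {y | u ≤ cdf μ y}) ⁻¹' Iic x =
        (Ioo 0 1 ∩ Iic (cdf μ x)) ∪ ((Ioo 0 1)ᶜ ∩ {_u | 0 ≤ x}) := by
      ext u
      by_cases hu : u ∈ Ioo (0 : ℝ) 1
      · have := sInf_le_iff_le_cdf μ hu x
        simpa [hu, -mem_Ioo] using this
      · simp [hu, -mem_Ioo]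
    rw [this]
    exact (measurableSet_Ioo.inter measurableSet_Iic).union
      (measurableSet_Ioo.compl.inter (MeasurableSet.const _))
  · rw [indicator_of_mem hu]
    exact sInf_le_iff_le_cdf μ hu x

namespace IsQuantile

variable {μ ν : Measure ℝ} {q r : ℝ → ℝ}

lemma monotoneOn (hq : IsQuantile q μ) : MonotoneOn q (Ioo 0 1) := fun u hu v hv huv =>
  (hq.2 u hu _).2 (huv.trans ((hq.2 v hv _).1 le_rfl))

lemma le_of_cdf_le (hq : IsQuantile q μ) (hr : IsQuantile r ν) (h : ∀ x, cdf ν x ≤ cdf μ x)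
    {u : ℝ} (hu : u ∈ Ioo (0 : ℝ) 1) : q u ≤ r u :=
  (hq.2 u hu _).2 (((hr.2 u hu _).1 le_rfl).trans (h _))

lemma map_unitUniform [IsProbabilityMeasure μ] (hq : IsQuantile q μ) :
    unitUniform.map q = μ := by
  have := Measure.isProbabilityMeasure_map (μ := unitUniform) hq.1.aemeasurable
  refine Measure.ext_of_Iic _ _ fun x => ?_
  rw [Measure.map_apply hq.1 measurableSet_Iic, ← ofReal_cdf,
    ← unitUniform_Iic (cdf_nonneg μ x) (cdf_le_one μ x)]
  refine measure_congr ?_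
  filter_upwards [ae_unitUniform_mem] with u hu
  exact propext (hq.2 u hu x)

end IsQuantile

/-- Stochastic dominance of finite measures of equal mass yields an ordered coupling. -/
lemma exists_coupling_le {α β : Measure ℝ} [IsFiniteMeasure α] [IsFiniteMeasure β]
    (hmass : α univ = β univ) (h : ∀ s, β (Iic s) ≤ α (Iic s)) :
    ∃ Q : Measure (ℝ × ℝ), Q.map Prod.fst = α ∧ Q.map Prod.snd = β ∧
      ∀ᵐ p ∂Q, p.1 ≤ p.2 := by
  by_cases h0 : α univ = 0
  · refine ⟨0, ?_, ?_, by simp⟩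
    · simp [Measure.measure_univ_eq_zero.1 h0]
    · simp [Measure.measure_univ_eq_zero.1 (hmass ▸ h0)]
  · have hα : α ≠ 0 := fun h => h0 (by simp [h])
    have hβ : β ≠ 0 := fun h => h0 (by simp [hmass, h])
    have : NeZero α := ⟨hα⟩
    have : NeZero β := ⟨hβ⟩
    set a : Measure ℝ := (α univ)⁻¹ • α with ha
    set b : Measure ℝ := (α univ)⁻¹ • β with hb
    have : IsProbabilityMeasure a := isProbabilityMeasureSMul
    have : IsProbabilityMeasure b := by rw [hb, hmass]; exact isProbabilityMeasureSMul
    obtain ⟨q, hq⟩ := exists_isQuantile a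
    obtain ⟨r, hr⟩ := exists_isQuantile b
    have hcdf : ∀ x, cdf b x ≤ cdf a x := fun x => by
      rw [cdf_eq_real, cdf_eq_real]
      refine ENNReal.toReal_mono (measure_ne_top _ _) ?_
      simp only [ha, hb, Measure.smul_apply, smul_eq_mul]
      exact mul_le_mul' le_rfl (h x)
    have hqr : Measurable fun u => (q u, r u) := hq.1.prodMk hr.1
    have hcancel : α univ * (α univ)⁻¹ = 1 := ENNReal.mul_inv_cancel h0 (measure_ne_top _ _)
    refine ⟨α univ • unitUniform.map fun u => (q u, r u), ?_, ?_, ?_⟩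
    · rw [Measure.map_smul, Measure.map_map measurable_fst hqr]
      change α univ • unitUniform.map q = α
      rw [hq.map_unitUniform, ha, smul_smul, hcancel, one_smul]
    · rw [Measure.map_smul, Measure.map_map measurable_snd hqr]
      change α univ • unitUniform.map r = β
      rw [hr.map_unitUniform, hb, smul_smul, hcancel, one_smul]
    · refine Measure.ae_smul_measure ?_ _
      rw [ae_map_iff hqr.aemeasurable (measurableSet_le measurable_fst measurable_snd)]
      filter_upwards [ae_unitUniform_mem] with u hu
      exact hq.le_of_cdf_le hr hcdf hu

section Spread

variable {E : Type*} [MeasurableSpace E] {X Y : E → ℝ} {L : Measure E} {Q : Measure (E × E)}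

/-- The joint law which keeps mass where `X = Y` and, over a `Q`-pair `(u, v)` with
`Y u < X u ≤ X v < Y v`, splits mass at `X u` and at `X v` between `Y u` and `Y v` so that
barycenters are preserved. -/
noncomputable def spreadCoupling (X Y : E → ℝ) (L : Measure E) (Q : Measure (E × E)) :
    Measure (ℝ × ℝ) :=
  (L.restrict {u | X u = Y u}).map (fun u => (X u, Y u)) +
  (Q.withDensity fun p => ENNReal.ofReal
    ((Y p.2 - X p.1) / ((X p.1 - Y p.1) * (Y p.2 - Y p.1)))).map (fun p => (X p.1, Y p.1)) +
  (Q.withDensity fun p => ENNReal.ofReal (1 / (Y p.2 - Y p.1))).map (fun p => (X p.1, Y p.2)) +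
  (Q.withDensity fun p => ENNReal.ofReal (1 / (Y p.2 - Y p.1))).map (fun p => (X p.2, Y p.1)) +
  (Q.withDensity fun p => ENNReal.ofReal
    ((X p.2 - Y p.1) / ((Y p.2 - X p.2) * (Y p.2 - Y p.1)))).map (fun p => (X p.2, Y p.2))

lemma lintegral_spreadCoupling (hX : Measurable X) (hY : Measurable Y) {f : ℝ × ℝ → ℝ≥0∞}
    (hf : Measurable f) :
    ∫⁻ z, f z ∂spreadCoupling X Y L Q =
      ∫⁻ u in {u | X u = Y u}, f (X u, Y u) ∂L +
      ∫⁻ p, (ENNReal.ofReal ((Y p.2 - X p.1) / ((X p.1 - Y p.1) * (Y p.2 - Y p.1))) *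
          f (X p.1, Y p.1) +
        ENNReal.ofReal (1 / (Y p.2 - Y p.1)) * f (X p.1, Y p.2) +
        ENNReal.ofReal (1 / (Y p.2 - Y p.1)) * f (X p.2, Y p.1) +
        ENNReal.ofReal ((X p.2 - Y p.1) / ((Y p.2 - X p.2) * (Y p.2 - Y p.1))) *
          f (X p.2, Y p.2)) ∂Q := by
  rw [lintegral_add_right _ (by fun_prop), lintegral_add_right _ (by fun_prop),
    lintegral_add_right _ (by fun_prop)]
  simp only [spreadCoupling, lintegral_add_measure]
  rw [lintegral_map hf (by fun_prop), lintegral_map hf (by fun_prop),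
    lintegral_map hf (by fun_prop), lintegral_map hf (by fun_prop),
    lintegral_map hf (by fun_prop),
    lintegral_withDensity_eq_lintegral_mul _ (by fun_prop) (by fun_prop),
    lintegral_withDensity_eq_lintegral_mul _ (by fun_prop) (by fun_prop),
    lintegral_withDensity_eq_lintegral_mul _ (by fun_prop) (by fun_prop),
    lintegral_withDensity_eq_lintegral_mul _ (by fun_prop) (by fun_prop)]
  simp only [Pi.mul_apply, add_assoc]

lemma lintegral_withDensity_sub_mul_inv (hX : Measurable X) (hY : Measurable Y) {F : E → ℝ≥0∞}
    (hF : Measurable F) :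
    ∫⁻ u, ENNReal.ofReal (1 / (X u - Y u)) * F u
        ∂(L.withDensity fun u => ENNReal.ofReal (X u - Y u)) =
      ∫⁻ u in {u | Y u < X u}, F u ∂L := by
  rw [lintegral_withDensity_eq_lintegral_mul _ (by fun_prop) (by fun_prop),
    ← lintegral_indicator (measurableSet_lt hY hX)]
  refine lintegral_congr fun u => ?_
  by_cases h : Y u < X u
  · have h' : 0 < X u - Y u := sub_pos.2 h
    rw [indicator_of_mem (by exact h), Pi.mul_apply, ← mul_assoc,
      ← ENNReal.ofReal_mul h'.le, mul_one_div_cancel h'.ne', ENNReal.ofReal_one, one_mul]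
  · rw [indicator_of_notMem (by exact h), Pi.mul_apply,
      ENNReal.ofReal_of_nonpos (sub_nonpos.2 (not_lt.1 h)), zero_mul]

lemma lintegral_eq_add_lintegral_coupling (hX : Measurable X) (hY : Measurable Y)
    (h1 : Q.map Prod.fst = L.withDensity fun u => ENNReal.ofReal (X u - Y u))
    (h2 : Q.map Prod.snd = L.withDensity fun u => ENNReal.ofReal (Y u - X u))
    {F : E → ℝ≥0∞} (hF : Measurable F) :
    ∫⁻ u in {u | X u = Y u}, F u ∂L +
      ∫⁻ p, (ENNReal.ofReal (1 / (X p.1 - Y p.1)) * F p.1 +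
        ENNReal.ofReal (1 / (Y p.2 - X p.2)) * F p.2) ∂Q = ∫⁻ u, F u ∂L := by
  have e1 : ∫⁻ p, ENNReal.ofReal (1 / (X p.1 - Y p.1)) * F p.1 ∂Q =
      ∫⁻ u in {u | Y u < X u}, F u ∂L := by
    rw [← lintegral_withDensity_sub_mul_inv hX hY hF, ← h1,
      lintegral_map (by fun_prop) measurable_fst]
  have e2 : ∫⁻ p, ENNReal.ofReal (1 / (Y p.2 - X p.2)) * F p.2 ∂Q =
      ∫⁻ u in {u | X u < Y u}, F u ∂L := by
    rw [← lintegral_withDensity_sub_mul_inv hY hX hF, ← h2,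
      lintegral_map (by fun_prop) measurable_snd]
  rw [lintegral_add_right _ (by fun_prop), e1, e2,
    ← lintegral_indicator (measurableSet_eq_fun hX hY),
    ← lintegral_indicator (measurableSet_lt hX hY),
    ← lintegral_indicator (measurableSet_lt hY hX),
    ← lintegral_add_right _ (hF.indicator (measurableSet_lt hX hY)),
    ← lintegral_add_left (hF.indicator (measurableSet_eq_fun hX hY))]
  refine lintegral_congr fun u => ?_
  rcases lt_trichotomy (X u) (Y u) with h | h | h
  · simp [indicator, h, h.ne, h.not_gt]
  · simp [indicator, h]
  · simp [indicator, h, h.ne', h.not_gt]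

lemma ae_coupling_lt (hX : Measurable X) (hY : Measurable Y)
    (h1 : Q.map Prod.fst = L.withDensity fun u => ENNReal.ofReal (X u - Y u))
    (h2 : Q.map Prod.snd = L.withDensity fun u => ENNReal.ofReal (Y u - X u)) :
    ∀ᵐ p ∂Q, Y p.1 < X p.1 ∧ X p.2 < Y p.2 := by
  have k1 : ∀ᵐ u ∂(Q.map Prod.fst), Y u < X u := by
    rw [h1, ae_withDensity_iff (by fun_prop)]
    exact .of_forall fun u hu => by simpa using hu
  have k2 : ∀ᵐ u ∂(Q.map Prod.snd), X u < Y u := by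
    rw [h2, ae_withDensity_iff (by fun_prop)]
    exact .of_forall fun u hu => by simpa using hu
  filter_upwards [ae_of_ae_map measurable_fst.aemeasurable k1,
    ae_of_ae_map measurable_snd.aemeasurable k2] with p hp hp' using ⟨hp, hp'⟩

variable (hX : Measurable X) (hY : Measurable Y)
  (h1 : Q.map Prod.fst = L.withDensity fun u => ENNReal.ofReal (X u - Y u))
  (h2 : Q.map Prod.snd = L.withDensity fun u => ENNReal.ofReal (Y u - X u))
  (hQ : ∀ᵐ p ∂Q, X p.1 ≤ X p.2)

include hX hY h1 h2 hQ

lemma map_fst_spreadCoupling : (spreadCoupling X Y L Q).map Prod.fst = L.map X := by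
  refine Measure.ext_of_lintegral _ fun f hf => ?_
  rw [lintegral_map hf measurable_fst, lintegral_map hf hX,
    lintegral_spreadCoupling hX hY (by fun_prop),
    ← lintegral_eq_add_lintegral_coupling hX hY h1 h2 (F := fun u => f (X u)) (hf.comp hX)]
  congr 1
  refine lintegral_congr_ae ?_
  filter_upwards [ae_coupling_lt hX hY h1 h2, hQ] with p ⟨ha, hb⟩ hab
  have a1 : 0 < X p.1 - Y p.1 := by linarith
  have a2 : 0 < Y p.2 - X p.2 := by linarith
  have a3 : 0 < Y p.2 - Y p.1 := by linarith
  have a4 : 0 < Y p.2 - X p.1 := by linarith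
  have a5 : 0 < X p.2 - Y p.1 := by linarith
  rw [← add_mul, add_assoc, ← add_mul, ← ENNReal.ofReal_add (by positivity) (by positivity),
    ← ENNReal.ofReal_add (by positivity) (by positivity)]
  congr 3
  · field_simp; ring
  · field_simp; ring

lemma map_snd_spreadCoupling : (spreadCoupling X Y L Q).map Prod.snd = L.map Y := by
  refine Measure.ext_of_lintegral _ fun f hf => ?_
  rw [lintegral_map hf measurable_snd, lintegral_map hf hY,
    lintegral_spreadCoupling hX hY (by fun_prop),
    ← lintegral_eq_add_lintegral_coupling hX hY h1 h2 (F := fun u => f (Y u)) (hf.comp hY)]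
  congr 1
  refine lintegral_congr_ae ?_
  filter_upwards [ae_coupling_lt hX hY h1 h2, hQ] with p ⟨ha, hb⟩ hab
  have a1 : 0 < X p.1 - Y p.1 := by linarith
  have a2 : 0 < Y p.2 - X p.2 := by linarith
  have a3 : 0 < Y p.2 - Y p.1 := by linarith
  have a4 : 0 < Y p.2 - X p.1 := by linarith
  have a5 : 0 < X p.2 - Y p.1 := by linarith
  rw [add_right_comm (ENNReal.ofReal _ * _), ← add_mul, add_assoc, ← add_mul,
    ← ENNReal.ofReal_add (by positivity) (by positivity),
    ← ENNReal.ofReal_add (by positivity) (by positivity)]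
  congr 3
  · field_simp; ring
  · field_simp; ring

lemma lintegral_posPart_spreadCoupling {g : ℝ → ℝ≥0∞} (hg : Measurable g) :
    ∫⁻ z, g z.1 * ENNReal.ofReal (z.2 - z.1) ∂spreadCoupling X Y L Q =
      ∫⁻ z, g z.1 * ENNReal.ofReal (z.1 - z.2) ∂spreadCoupling X Y L Q := by
  rw [lintegral_spreadCoupling hX hY (by fun_prop), lintegral_spreadCoupling hX hY (by fun_prop)]
  congr 1
  · refine setLIntegral_congr_fun (measurableSet_eq_fun hX hY) fun u hu => ?_
    simp only [mem_ofPred_eq] at hu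
    simp [hu]
  · refine lintegral_congr_ae ?_
    filter_upwards [ae_coupling_lt hX hY h1 h2, hQ] with p ⟨ha, hb⟩ hab
    have a1 : 0 < X p.1 - Y p.1 := by linarith
    have a2 : 0 < Y p.2 - X p.2 := by linarith
    have a3 : 0 < Y p.2 - Y p.1 := by linarith
    have a4 : 0 < Y p.2 - X p.1 := by linarith
    have a5 : 0 < X p.2 - Y p.1 := by linarith
    have n1 : ENNReal.ofReal (Y p.1 - X p.1) = 0 := ENNReal.ofReal_of_nonpos (by linarith)
    have n2 : ENNReal.ofReal (X p.2 - Y p.2) = 0 := ENNReal.ofReal_of_nonpos (by linarith)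
    have n3 : ENNReal.ofReal (Y p.1 - X p.2) = 0 := ENNReal.ofReal_of_nonpos (by linarith)
    have n4 : ENNReal.ofReal (X p.1 - Y p.2) = 0 := ENNReal.ofReal_of_nonpos (by linarith)
    simp only [n1, n2, n3, n4, mul_zero, zero_add, add_zero, mul_left_comm _ (g _)]
    rw [← ENNReal.ofReal_mul (by positivity), ← ENNReal.ofReal_mul (by positivity),
      ← ENNReal.ofReal_mul (by positivity), ← ENNReal.ofReal_mul (by positivity)]
    congr 3
    · field_simp
    · field_simp

end Spread

lemma lintegral_Iic_ofReal_cdf (μ : Measure ℝ) [IsProbabilityMeasure μ] (y : ℝ) :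
    ∫⁻ t in Iic y, ENNReal.ofReal (cdf μ t) = ∫⁻ x, ENNReal.ofReal (max (y - x) 0) ∂μ := by
  have hS : MeasurableSet {p : ℝ × ℝ | p.2 ≤ p.1} := measurableSet_le measurable_snd measurable_fst
  have hmeas : Measurable (Function.uncurry fun t x : ℝ => (Iic t).indicator (1 : ℝ → ℝ≥0∞) x) :=
    (measurable_one.indicator hS :
      Measurable ({p : ℝ × ℝ | p.2 ≤ p.1}.indicator (1 : ℝ × ℝ → ℝ≥0∞)))
  calc ∫⁻ t in Iic y, ENNReal.ofReal (cdf μ t)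
      = ∫⁻ t in Iic y, ∫⁻ x, (Iic t).indicator (1 : ℝ → ℝ≥0∞) x ∂μ := by
        refine lintegral_congr fun t => ?_
        rw [ofReal_cdf, lintegral_indicator_one measurableSet_Iic]
    _ = ∫⁻ x, (∫⁻ t in Iic y, (Iic t).indicator (1 : ℝ → ℝ≥0∞) x) ∂μ :=
        lintegral_lintegral_swap hmeas.aemeasurable
    _ = ∫⁻ x, ENNReal.ofReal (max (y - x) 0) ∂μ := by
        refine lintegral_congr fun x => ?_
        have : (fun t => (Iic t).indicator (1 : ℝ → ℝ≥0∞) x) = (Ici x).indicator 1 := by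
          ext t
          simp [indicator]
        rw [this, lintegral_indicator_one measurableSet_Ici,
          Measure.restrict_apply measurableSet_Ici, Ici_inter_Iic, Real.volume_Icc]
        rcases le_total (y - x) 0 with h | h
        · rw [max_eq_right h, ENNReal.ofReal_of_nonpos h, ENNReal.ofReal_zero]
        · rw [max_eq_left h]

lemma MeasureTheory.Integrable.max_const_sub {Ω : Type*} [MeasurableSpace Ω] {P : Measure Ω}
    [IsFiniteMeasure P] {X : Ω → ℝ} (hX : Integrable X P) (y : ℝ) :
    Integrable (fun ω => max (y - X ω) 0) P :=
  ((integrable_const y).sub hX).pos_part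

lemma integrableOn_Iic_cdf {μ : Measure ℝ} [IsProbabilityMeasure μ]
    (hμ : Integrable (fun x => x) μ) (y : ℝ) : IntegrableOn (fun t => cdf μ t) (Iic y) := by
  refine (lintegral_ofReal_ne_top_iff_integrable
    (monotone_cdf μ).measurable.aestronglyMeasurable (.of_forall fun t => cdf_nonneg μ t)).1 ?_
  rw [lintegral_Iic_ofReal_cdf]
  exact (lintegral_ofReal_ne_top_iff_integrable (hμ.max_const_sub y).1
    (.of_forall fun x => le_max_right _ _)).2 (hμ.max_const_sub y)

lemma setIntegral_Iic_cdf (μ : Measure ℝ) [IsProbabilityMeasure μ] (y : ℝ) :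
    ∫ t in Iic y, cdf μ t = ∫ x, max (y - x) 0 ∂μ := by
  rw [integral_eq_lintegral_of_nonneg_ae (.of_forall fun t => cdf_nonneg μ t)
      (monotone_cdf μ).measurable.aestronglyMeasurable,
    integral_eq_lintegral_of_nonneg_ae (f := fun x => max (y - x) 0)
      (.of_forall fun x => le_max_right _ _)
      (by fun_prop), lintegral_Iic_ofReal_cdf]

lemma setIntegral_Iic_cdf_sub_nonneg_iff {μ ν : Measure ℝ} [IsProbabilityMeasure μ]
    [IsProbabilityMeasure ν] (hμ : Integrable (fun x => x) μ) (hν : Integrable (fun x => x) ν)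
    (y : ℝ) : 0 ≤ ∫ t in Iic y, (cdf μ t - cdf ν t) ↔
      ∫ x, max (y - x) 0 ∂ν ≤ ∫ x, max (y - x) 0 ∂μ := by
  rw [integral_sub (integrableOn_Iic_cdf hμ y) (integrableOn_Iic_cdf hν y),
    setIntegral_Iic_cdf, setIntegral_Iic_cdf, sub_nonneg]

/-- Conditional Jensen inequality for the functions `x ↦ (y - x)⁺`. -/
lemma integral_max_const_sub_le_of_condExp {Ω : Type*} {m mΩ : MeasurableSpace Ω} {P : Measure Ω}
    [IsProbabilityMeasure P] {X Z : Ω → ℝ} (hm : m ≤ mΩ) (hX : Integrable X P)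
    (hZ : Measurable[m] Z) (h : P[X | m] =ᵐ[P] Z) (y : ℝ) :
    ∫ ω, max (y - Z ω) 0 ∂P ≤ ∫ ω, max (y - X ω) 0 ∂P := by
  have hZi : Integrable Z P := integrable_condExp.congr h
  have hA : MeasurableSet[m] {ω | Z ω < y} := hZ measurableSet_Iio
  have hA' := hm _ hA
  have key : ∫ ω in {ω | Z ω < y}, Z ω ∂P = ∫ ω in {ω | Z ω < y}, X ω ∂P := by
    rw [← setIntegral_condExp hm hX hA]
    exact (integral_congr_ae (ae_restrict_of_ae h)).symm
  have hZA : ∫ ω, max (y - Z ω) 0 ∂P = ∫ ω in {ω | Z ω < y}, (y - Z ω) ∂P := by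
    rw [← integral_indicator hA']
    refine integral_congr_ae (.of_forall fun ω => ?_)
    by_cases hω : Z ω < y
    · simp [indicator, hω, hω.le]
    · simp [indicator, hω, not_lt.1 hω]
  have hint {W : Ω → ℝ} (hW : Integrable W P) : Integrable (fun ω => y - W ω) P :=
    (integrable_const y).sub hW
  calc ∫ ω, max (y - Z ω) 0 ∂P = ∫ ω in {ω | Z ω < y}, (y - X ω) ∂P := by
        rw [hZA, integral_sub (integrable_const y) hZi.integrableOn,
          integral_sub (integrable_const y) hX.integrableOn, key]
    _ ≤ ∫ ω in {ω | Z ω < y}, max (y - X ω) 0 ∂P :=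
        integral_mono (hint hX).integrableOn (hX.max_const_sub y).integrableOn
          fun ω => le_max_left _ _
    _ ≤ ∫ ω, max (y - X ω) 0 ∂P :=
        setIntegral_le_integral (hX.max_const_sub y) (.of_forall fun ω => le_max_right _ _)

lemma integrable_id_map {Ω : Type*} [MeasurableSpace Ω] {P : Measure Ω} {X : Ω → ℝ}
    (hX : Measurable X) : Integrable (fun x => x) (P.map X) ↔ Integrable X P :=
  integrable_map_measure measurable_id.aestronglyMeasurable hX.aemeasurable

lemma mean_preserving_spread_of_H0 {μ ν : Measure ℝ} (hμ : Integrable (fun x => x) μ)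
    (h : H0 μ ν) :
    (∀ y, ∫ x, max (y - x) 0 ∂ν ≤ ∫ x, max (y - x) 0 ∂μ) ∧ ∫ x, x ∂μ = ∫ x, x ∂ν := by
  obtain ⟨Ω, mΩ, P, hP, X, Z, hX, hZ, rfl, rfl, hc⟩ := h
  have hXi : Integrable X P := (integrable_id_map hX).1 hμ
  have hmap {W : Ω → ℝ} (hW : Measurable W) (y : ℝ) :
      ∫ x, max (y - x) 0 ∂(P.map W) = ∫ ω, max (y - W ω) 0 ∂P :=
    integral_map hW.aemeasurable (by fun_prop)
  simp only [hmap hX, hmap hZ]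
  rw [integral_map hZ.aemeasurable (by fun_prop), integral_map hX.aemeasurable (by fun_prop)]
  obtain ⟨m, hm, hZm, hc⟩ := hc
  refine ⟨integral_max_const_sub_le_of_condExp hm hXi (measurable_iff_comap_le.2 hZm) hc, ?_⟩
  rw [← integral_condExp hm]
  exact integral_congr_ae hc

/-- If the integrals of `(y - x)⁺` are ordered, then so are the integrals of the quantile
functions over initial segments of the unit interval. -/
lemma setIntegral_Iic_quantile_le {μ ν : Measure ℝ} [IsProbabilityMeasure μ]
    [IsProbabilityMeasure ν] {q r : ℝ → ℝ} (hq : IsQuantile q μ) (hr : IsQuantile r ν)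
    (hμ : Integrable (fun x => x) μ) (hν : Integrable (fun x => x) ν)
    (h : ∀ y, ∫ x, max (y - x) 0 ∂ν ≤ ∫ x, max (y - x) 0 ∂μ) {s : ℝ} (hs : s ∈ Ioo (0 : ℝ) 1) :
    ∫ u in Iic s, q u ∂unitUniform ≤ ∫ u in Iic s, r u ∂unitUniform := by
  have hqi : Integrable q unitUniform := by
    rwa [← integrable_id_map hq.1, hq.map_unitUniform]
  have hri : Integrable r unitUniform := by
    rwa [← integrable_id_map hr.1, hr.map_unitUniform]
  have hle := h (q s)
  rw [← hq.map_unitUniform, ← hr.map_unitUniform,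
    integral_map hr.1.aemeasurable (by fun_prop), integral_map hq.1.aemeasurable (by fun_prop)]
    at hle
  have hqs : ∫ u, max (q s - q u) 0 ∂unitUniform = ∫ u in Iic s, (q s - q u) ∂unitUniform := by
    rw [← integral_indicator measurableSet_Iic]
    refine integral_congr_ae ?_
    filter_upwards [ae_unitUniform_mem] with u hu
    by_cases hus : u ≤ s
    · simp [indicator, hus, hq.monotoneOn hu hs hus]
    · simp [indicator, hus, hq.monotoneOn hs hu (not_le.1 hus).le]
  have hrs : ∫ u in Iic s, (q s - r u) ∂unitUniform ≤ ∫ u, max (q s - r u) 0 ∂unitUniform :=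
    (integral_mono ((integrable_const _).sub hri).integrableOn
      (hri.max_const_sub _).integrableOn fun u => le_max_left _ _).trans
      (setIntegral_le_integral (hri.max_const_sub _) (.of_forall fun u => le_max_right _ _))
  have := hrs.trans (hle.trans_eq hqs)
  rw [integral_sub (integrable_const _) hri.integrableOn,
    integral_sub (integrable_const _) hqi.integrableOn] at this
  linarith

lemma withDensity_ofReal_sub_le {E : Type*} [MeasurableSpace E] {L : Measure E}
    {X Y : E → ℝ} (hX : Integrable X L) (hY : Integrable Y L) {s : Set E} (hs : MeasurableSet s)
    (h : ∫ u in s, Y u ∂L ≤ ∫ u in s, X u ∂L) :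
    L.withDensity (fun u => ENNReal.ofReal (Y u - X u)) s ≤
      L.withDensity (fun u => ENNReal.ofReal (X u - Y u)) s := by
  have hi : Integrable (fun u => X u - Y u) (L.restrict s) := (hX.sub hY).integrableOn
  have hi' : Integrable (fun u => Y u - X u) (L.restrict s) := (hY.sub hX).integrableOn
  have := integral_eq_lintegral_pos_part_sub_lintegral_neg_part hi
  rw [integral_sub hX.integrableOn hY.integrableOn] at this
  simp only [neg_sub] at this
  rw [withDensity_apply _ hs, withDensity_apply _ hs,
    ← ENNReal.toReal_le_toReal hi'.lintegral_lt_top.ne hi.lintegral_lt_top.ne]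
  linarith

/-- A coupling whose conditional increments have balanced positive and negative parts is a
martingale coupling. -/
lemma condExp_snd_of_lintegral_posPart {P : Measure (ℝ × ℝ)} [IsProbabilityMeasure P]
    (hX : Integrable Prod.fst P) (hY : Integrable Prod.snd P)
    (h : ∀ g : ℝ → ℝ≥0∞, Measurable g → ∫⁻ z, g z.1 * ENNReal.ofReal (z.2 - z.1) ∂P =
      ∫⁻ z, g z.1 * ENNReal.ofReal (z.1 - z.2) ∂P) :
    P[Prod.snd | MeasurableSpace.comap Prod.fst Real.measurableSpace] =ᵐ[P] Prod.fst := by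
  refine (ae_eq_condExp_of_forall_setIntegral_eq measurable_fst.comap_le hY
    (fun s _ _ => hX.integrableOn) ?_
    (comap_measurable Prod.fst).stronglyMeasurable.aestronglyMeasurable).symm
  rintro _ ⟨A, hA, rfl⟩ -
  have hA' : MeasurableSet (Prod.fst ⁻¹' A : Set (ℝ × ℝ)) := measurable_fst hA
  have hind (f : ℝ × ℝ → ℝ≥0∞) : ∫⁻ z in Prod.fst ⁻¹' A, f z ∂P =
      ∫⁻ z, A.indicator 1 z.1 * f z ∂P := by
    rw [← lintegral_indicator hA']
    refine lintegral_congr fun z => ?_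
    by_cases hz : z.1 ∈ A <;> simp [hz]
  have hi : Integrable (fun z : ℝ × ℝ => z.2 - z.1) (P.restrict (Prod.fst ⁻¹' A)) :=
    (hY.sub hX).integrableOn
  have := integral_eq_lintegral_pos_part_sub_lintegral_neg_part hi
  simp only [neg_sub] at this
  rw [integral_sub hY.integrableOn hX.integrableOn, hind, hind,
    h _ (measurable_one.indicator hA), sub_self] at this
  exact (sub_eq_zero.1 this).symm

/-- One-dimensional Strassen theorem: the convex order implies the existence of a martingale
coupling. -/
lemma H0_of_mean_preserving_spread {μ ν : Measure ℝ} [IsProbabilityMeasure μ]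
    [IsProbabilityMeasure ν] (hμ : Integrable (fun x => x) μ) (hν : Integrable (fun x => x) ν)
    (h : ∀ y, ∫ x, max (y - x) 0 ∂ν ≤ ∫ x, max (y - x) 0 ∂μ)
    (hmean : ∫ x, x ∂μ = ∫ x, x ∂ν) : H0 μ ν := by
  obtain ⟨Y, hY⟩ := exists_isQuantile μ
  obtain ⟨X, hX⟩ := exists_isQuantile ν
  set L := unitUniform
  have hYi : Integrable Y L := by rwa [← integrable_id_map hY.1, hY.map_unitUniform]
  have hXi : Integrable X L := by rwa [← integrable_id_map hX.1, hX.map_unitUniform]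
  have hXY : ∫ u, Y u ∂L = ∫ u, X u ∂L := by
    rw [← hY.map_unitUniform, ← hX.map_unitUniform, integral_map hY.1.aemeasurable (by fun_prop),
      integral_map hX.1.aemeasurable (by fun_prop)] at hmean
    exact hmean
  set α := L.withDensity fun u => ENNReal.ofReal (X u - Y u)
  set β := L.withDensity fun u => ENNReal.ofReal (Y u - X u)
  have : IsFiniteMeasure α := isFiniteMeasure_withDensity_ofReal (hXi.sub hYi).2
  have : IsFiniteMeasure β := isFiniteMeasure_withDensity_ofReal (hYi.sub hXi).2
  have hmass : α univ = β univ := le_antisymm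
    (withDensity_ofReal_sub_le hYi hXi .univ (by simpa using hXY.ge))
    (withDensity_ofReal_sub_le hXi hYi .univ (by simpa using hXY.le))
  have hdom (s : ℝ) : β (Iic s) ≤ α (Iic s) := by
    refine withDensity_ofReal_sub_le hXi hYi measurableSet_Iic ?_
    rcases le_or_gt s 0 with h0 | h0
    · have : L.restrict (Iic s) = 0 := by
        rw [Measure.restrict_eq_zero]
        refine measure_mono_null (Iic_subset_Iic.2 h0) ?_
        rw [unitUniform_Iic le_rfl zero_le_one, ENNReal.ofReal_zero]
      simp [this]
    rcases lt_or_ge s 1 with h1 | h1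
    · exact setIntegral_Iic_quantile_le hY hX hμ hν h ⟨h0, h1⟩
    · have : L.restrict (Iic s) = L := Measure.restrict_eq_self_of_ae_mem <| by
        filter_upwards [ae_unitUniform_mem] with u hu using hu.2.le.trans h1
      rw [this]
      exact hXY.le
  obtain ⟨Q, h1, h2, hQ⟩ := exists_coupling_le hmass hdom
  have hmem1 : ∀ᵐ u ∂(Q.map Prod.fst), u ∈ Ioo (0 : ℝ) 1 := by
    rw [h1]
    exact (withDensity_absolutelyContinuous _ _).ae_le ae_unitUniform_mem
  have hmem2 : ∀ᵐ u ∂(Q.map Prod.snd), u ∈ Ioo (0 : ℝ) 1 := by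
    rw [h2]
    exact (withDensity_absolutelyContinuous _ _).ae_le ae_unitUniform_mem
  have hQX : ∀ᵐ p ∂Q, X p.1 ≤ X p.2 := by
    filter_upwards [hQ, ae_of_ae_map measurable_fst.aemeasurable hmem1,
      ae_of_ae_map measurable_snd.aemeasurable hmem2] with p hp hp1 hp2
    exact hX.monotoneOn hp1 hp2 hp
  have hfst := map_fst_spreadCoupling hX.1 hY.1 h1 h2 hQX
  have hsnd := map_snd_spreadCoupling hX.1 hY.1 h1 h2 hQX
  rw [hX.map_unitUniform] at hfst
  rw [hY.map_unitUniform] at hsnd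
  have hP : IsProbabilityMeasure (spreadCoupling X Y L Q) :=
    (Measure.isProbabilityMeasure_map_iff measurable_fst.aemeasurable).1 (hfst ▸ ‹_›)
  refine ⟨ℝ × ℝ, inferInstance, spreadCoupling X Y L Q, hP, Prod.snd, Prod.fst, measurable_snd,
    measurable_fst, hsnd, hfst, MeasurableSpace.comap Prod.fst Real.measurableSpace,
    measurable_fst.comap_le, le_rfl, ?_⟩
  refine condExp_snd_of_lintegral_posPart ?_ ?_ fun g hg =>
    lintegral_posPart_spreadCoupling hX.1 hY.1 h1 h2 hQX hg
  · rwa [← integrable_id_map measurable_fst, hfst]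
  · rwa [← integrable_id_map measurable_snd, hsnd]

end Auxiliary

/-- Theorem 1 (i) ⇔ (ii) of the paper: H₀ holds if and only if
`Δ(y) = ∫_{-∞}^y (F_Y(t) - F_ψ(t)) dt ≥ 0` for all `y` and `E[Y] = E[ψ]`,
i.e. `F_Y` is a mean-preserving spread of `F_ψ`. -/
theorem H0_iff_mean_preserving_spread
    {Ω₁ Ω₂ : Type} [MeasurableSpace Ω₁] [MeasurableSpace Ω₂]
    (P₁ : Measure Ω₁) (P₂ : Measure Ω₂)
    [IsProbabilityMeasure P₁] [IsProbabilityMeasure P₂]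
    {Y : Ω₁ → ℝ} {ψ : Ω₂ → ℝ}
    (hYm : Measurable Y) (hψm : Measurable ψ)
    (hYi : Integrable Y P₁) (hψi : Integrable ψ P₂) :
    H0 (P₁.map Y) (P₂.map ψ) ↔
      ((∀ y : ℝ, 0 ≤ ∫ t in Set.Iic y, (cdf (P₁.map Y) t - cdf (P₂.map ψ) t)) ∧
        ∫ ω, Y ω ∂P₁ = ∫ ω, ψ ω ∂P₂) := by
  have := Measure.isProbabilityMeasure_map (μ := P₁) hYm.aemeasurable
  have := Measure.isProbabilityMeasure_map (μ := P₂) hψm.aemeasurable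
  have hμ := (integrable_id_map hYm).2 hYi
  have hν := (integrable_id_map hψm).2 hψi
  have hmean : ∫ ω, Y ω ∂P₁ = ∫ ω, ψ ω ∂P₂ ↔ ∫ x, x ∂(P₁.map Y) = ∫ x, x ∂(P₂.map ψ) := by
    rw [integral_map hYm.aemeasurable (by fun_prop), integral_map hψm.aemeasurable (by fun_prop)]
  rw [hmean, forall_congr' (setIntegral_Iic_cdf_sub_nonneg_iff hμ hν)]
  exact ⟨mean_preserving_spread_of_H0 hμ, fun h => H0_of_mean_preserving_spread hμ hν h.1 h.2⟩
end

section
/- Let Y and ψ be integrable real random variables. Then H₀ holds if and only if E[(y − Y)⁺] − E[(y − ψ)⁺] ≥ 0 for all y ∈ ℝ and E[Y] = E[ψ]. In particular, there exists a pair of random variables (Y', ψ') on some probability space with Y' distributed as Y, ψ' distributed as ψ and E[Y' | σ(ψ')] = ψ' almost surely, if and only if the stated family of moment inequalities and the moment equality hold. -/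
open MeasureTheory ProbabilityTheory

/-- The reformulation of H₀ where the conditioning σ-algebra is exactly `σ(ψ')`. -/
def H0ViaBeliefOn (Ω : Type) [mΩ : MeasurableSpace Ω] (P : Measure Ω)
    (μY μψ : Measure ℝ) : Prop :=
  IsProbabilityMeasure P ∧
    ∃ Y' ψ' : Ω → ℝ,
      Measurable Y' ∧ Measurable ψ' ∧
      P.map Y' = μY ∧ P.map ψ' = μψ ∧
      P[Y' | MeasurableSpace.comap ψ' Real.measurableSpace] =ᵐ[P] ψ'

/-- The left-continuous quantile function of a measure on `ℝ`, extended by `0` outside `(0, 1)`. -/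
noncomputable def quantile (μ : Measure ℝ) (p : ℝ) : ℝ :=
  open Classical in if p ∈ Set.Ioo (0 : ℝ) 1 then sInf {x | p ≤ cdf μ x} else 0

lemma quantile_le_iff (μ : Measure ℝ) {p : ℝ} (hp : p ∈ Set.Ioo (0 : ℝ) 1) (x : ℝ) :
    quantile μ p ≤ x ↔ p ≤ cdf μ x := by
  have hbdd : BddBelow {x | p ≤ cdf μ x} := by
    obtain ⟨b, hb⟩ := ((tendsto_cdf_atBot μ).eventually_lt_const hp.1).exists
    refine ⟨b, fun z hz ↦ ?_⟩
    by_contra! h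
    exact absurd (hz.trans (monotone_cdf μ h.le)) hb.not_ge
  have hne : {x | p ≤ cdf μ x}.Nonempty :=
    ((tendsto_cdf_atTop μ).eventually_const_le hp.2).exists
  rw [quantile, if_pos hp]
  refine ⟨fun h ↦ ?_, fun h ↦ csInf_le hbdd h⟩
  have hright : Filter.Tendsto (cdf μ) (nhdsWithin x (Set.Ioi x)) (nhds (cdf μ x)) :=
    ((cdf μ).right_continuous x).mono_left (nhdsWithin_mono _ Set.Ioi_subset_Ici_self)
  refine ge_of_tendsto hright ?_
  filter_upwards [self_mem_nhdsWithin] with z hz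
  obtain ⟨w, hw, hwz⟩ := exists_lt_of_csInf_lt hne (h.trans_lt hz)
  exact le_trans hw (monotone_cdf μ hwz.le)

lemma monotoneOn_quantile (μ : Measure ℝ) : MonotoneOn (quantile μ) (Set.Ioo 0 1) :=
  fun _ hp _ hq hpq ↦
    (quantile_le_iff μ hp _).2 (hpq.trans ((quantile_le_iff μ hq _).1 le_rfl))

lemma measurable_quantile (μ : Measure ℝ) : Measurable (quantile μ) := by
  refine measurable_of_Iic fun x ↦ ?_
  have h : quantile μ ⁻¹' Set.Iic x =
      (Set.Ioo 0 1 ∩ Set.Iic (cdf μ x)) ∪ ((Set.Ioo 0 1)ᶜ ∩ {_p | 0 ≤ x}) := by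
    ext p
    by_cases hp : p ∈ Set.Ioo (0 : ℝ) 1
    · simp only [Set.mem_preimage, Set.mem_Iic, quantile_le_iff μ hp, Set.mem_union,
        Set.mem_inter_iff, hp, Set.mem_compl_iff]
      simp
    · simp only [Set.mem_preimage, Set.mem_Iic, quantile, Set.mem_union,
        Set.mem_inter_iff, hp, Set.mem_compl_iff]
      simp
  rw [h]
  exact (measurableSet_Ioo.inter measurableSet_Iic).union
    (measurableSet_Ioo.compl.inter (MeasurableSet.const _))

/-- The uniform probability measure on `(0, 1)`, as a measure on `ℝ`. -/
noncomputable def uniformIoo : Measure ℝ := volume.restrict (Set.Ioo 0 1)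

instance : IsProbabilityMeasure uniformIoo := ⟨by simp [uniformIoo]⟩

lemma ae_mem_Ioo_uniformIoo : ∀ᵐ p ∂uniformIoo, p ∈ Set.Ioo (0 : ℝ) 1 :=
  ae_restrict_mem measurableSet_Ioo

lemma map_quantile_uniformIoo (μ : Measure ℝ) [IsProbabilityMeasure μ] :
    uniformIoo.map (quantile μ) = μ := by
  have := Measure.isProbabilityMeasure_map (μ := uniformIoo) (measurable_quantile μ).aemeasurable
  refine Measure.ext_of_Iic _ _ fun x ↦ ?_
  rw [Measure.map_apply (measurable_quantile μ) measurableSet_Iic]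
  have h : quantile μ ⁻¹' Set.Iic x =ᵐ[uniformIoo] Set.Iic (cdf μ x) := by
    filter_upwards [ae_mem_Ioo_uniformIoo] with p hp
    exact propext (quantile_le_iff μ hp x)
  rw [measure_congr h, uniformIoo, Measure.restrict_apply measurableSet_Iic, ← ofReal_cdf]
  refine le_antisymm ?_ ?_
  · calc volume (Set.Iic (cdf μ x) ∩ Set.Ioo 0 1) ≤ volume (Set.Ioc 0 (cdf μ x)) :=
          measure_mono fun p hp ↦ Set.mem_Ioc.2 ⟨hp.2.1, hp.1⟩
      _ = _ := by simp
  · calc ENNReal.ofReal (cdf μ x) = volume (Set.Ioo 0 (cdf μ x)) := by simp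
      _ ≤ volume (Set.Iic (cdf μ x) ∩ Set.Ioo 0 1) := measure_mono fun p hp ↦
          Set.mem_inter hp.2.le ⟨hp.1, hp.2.trans_le (cdf_le_one μ x)⟩

/-- Two finite measures on `ℝ` of equal mass that are stochastically ordered admit an ordered
coupling. -/
lemma exists_coupling_le_of_measure_Iic_le (α β : Measure ℝ) [IsFiniteMeasure α]
    [IsFiniteMeasure β] (hmass : α Set.univ = β Set.univ)
    (hle : ∀ t, β (Set.Iic t) ≤ α (Set.Iic t)) :
    ∃ π : Measure (ℝ × ℝ), π.map Prod.fst = α ∧ π.map Prod.snd = β ∧ ∀ᵐ p ∂π, p.1 ≤ p.2 := by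
  rcases eq_or_ne (α Set.univ) 0 with h0 | h0
  · refine ⟨0, ?_, ?_, by simp⟩
    · simp [Measure.measure_univ_eq_zero.1 h0]
    · simp [Measure.measure_univ_eq_zero.1 (hmass ▸ h0)]
  set m := α Set.univ with hm
  have hmt : m ≠ ⊤ := measure_ne_top _ _
  have hα : IsProbabilityMeasure (m⁻¹ • α) :=
    ⟨by simp [← hm, ENNReal.inv_mul_cancel h0 hmt]⟩
  have hβ : IsProbabilityMeasure (m⁻¹ • β) :=
    ⟨by simp [← hmass, ENNReal.inv_mul_cancel h0 hmt]⟩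
  have hcdf (t : ℝ) : cdf (m⁻¹ • β) t ≤ cdf (m⁻¹ • α) t := by
    rw [cdf_eq_real, cdf_eq_real, measureReal_def, measureReal_def]
    refine ENNReal.toReal_mono (measure_ne_top _ _) ?_
    simpa using mul_le_mul_right (hle t) m⁻¹
  have hα' := measurable_quantile (m⁻¹ • α)
  have hβ' := measurable_quantile (m⁻¹ • β)
  refine ⟨m • uniformIoo.map fun w ↦ (quantile (m⁻¹ • α) w, quantile (m⁻¹ • β) w), ?_, ?_, ?_⟩
  · rw [Measure.map_smul, Measure.map_map measurable_fst (hα'.prodMk hβ')]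
    change m • uniformIoo.map (quantile (m⁻¹ • α)) = α
    rw [map_quantile_uniformIoo, smul_smul, ENNReal.mul_inv_cancel h0 hmt, one_smul]
  · rw [Measure.map_smul, Measure.map_map measurable_snd (hα'.prodMk hβ')]
    change m • uniformIoo.map (quantile (m⁻¹ • β)) = β
    rw [map_quantile_uniformIoo, smul_smul, ENNReal.mul_inv_cancel h0 hmt, one_smul]
  · refine Measure.ae_smul_measure ?_ m
    rw [ae_map_iff (hα'.prodMk hβ').aemeasurable (measurableSet_le measurable_fst measurable_snd)]
    filter_upwards [ae_mem_Ioo_uniformIoo] with w hw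
    exact (quantile_le_iff _ hw _).2 (((quantile_le_iff _ hw _).1 le_rfl).trans (hcdf _))

section Swap

variable {T : Type*} [MeasurableSpace T]

lemma map_withDensity_comp {S : Type*} [MeasurableSpace S] (π : Measure T) {f : T → S}
    (hf : Measurable f) {g : S → ENNReal} (hg : Measurable g) :
    (π.withDensity (g ∘ f)).map f = (π.map f).withDensity g := by
  ext s hs
  rw [Measure.map_apply hf hs, withDensity_apply _ (hf hs), withDensity_apply _ hs,
    Measure.restrict_map hf hs, lintegral_map hg hf]
  rfl

lemma withDensity_ofReal_withDensity_ofReal_inv (μ : Measure T) {d : T → ℝ} (hd : Measurable d) :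
    (μ.withDensity fun t ↦ ENNReal.ofReal (d t)).withDensity
      (fun t ↦ ENNReal.ofReal (1 / d t)) = μ.restrict {t | 0 < d t} := by
  have hs : MeasurableSet {t | 0 < d t} := measurableSet_lt measurable_const hd
  rw [← withDensity_mul _ (by fun_prop) (by fun_prop), ← withDensity_indicator_one hs]
  congr 1
  ext t
  by_cases h : 0 < d t
  · rw [Pi.mul_apply, ← ENNReal.ofReal_mul h.le, mul_one_div_cancel h.ne']
    simp [h]
  · simp [h, ENNReal.ofReal_of_nonpos (not_lt.1 h)]

lemma map_withDensity_one_div_eq_restrict {S : Type*} [MeasurableSpace S] {μ : Measure T}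
    {d : T → ℝ} (hd : Measurable d) {π : Measure S} {f : S → T} (hf : Measurable f)
    (hπ : π.map f = μ.withDensity fun t ↦ ENNReal.ofReal (d t)) :
    (π.withDensity fun p ↦ ENNReal.ofReal (1 / d (f p))).map f = μ.restrict {t | 0 < d t} := by
  rw [← withDensity_ofReal_withDensity_ofReal_inv μ hd, ← hπ,
    ← map_withDensity_comp π hf (by fun_prop)]
  rfl

lemma ae_pos_of_map_eq_withDensity {S : Type*} [MeasurableSpace S] {μ : Measure T}
    {d : T → ℝ} (hd : Measurable d) {π : Measure S} {f : S → T} (hf : Measurable f)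
    (hπ : π.map f = μ.withDensity fun t ↦ ENNReal.ofReal (d t)) :
    ∀ᵐ p ∂π, 0 < d (f p) := by
  refine ae_of_ae_map (p := fun t ↦ 0 < d t) hf.aemeasurable ?_
  rw [hπ, ae_withDensity_iff (by fun_prop)]
  refine Filter.Eventually.of_forall fun t ht ↦ ?_
  simpa using ht

/-- Given `x` and `y` on a measure space and an ordered transport `π` of the positive part of
`x - y` to its negative part, swapping mass between `y p.1` and `y p.2` along `π` turns the joint
law of `(x, y)` into that of a one-step martingale with the same marginals. -/
lemma exists_martingale_coupling_of_transport (μ : Measure T) {x y : T → ℝ}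
    (hx : Measurable x) (hy : Measurable y) (hxi : Integrable x μ) (hyi : Integrable y μ)
    (π : Measure (T × T))
    (hπ₁ : π.map Prod.fst = μ.withDensity fun t ↦ ENNReal.ofReal (x t - y t))
    (hπ₂ : π.map Prod.snd = μ.withDensity fun t ↦ ENNReal.ofReal (y t - x t))
    (hxy : ∀ᵐ p ∂π, x p.1 ≤ y p.2) (hyx : ∀ᵐ p ∂π, y p.1 ≤ x p.2) :
    ∃ M : Measure (ℝ × ℝ), M.map Prod.fst = μ.map x ∧ M.map Prod.snd = μ.map y ∧
      ∀ s, MeasurableSet s → ∫ p in Prod.fst ⁻¹' s, (p.2 - p.1) ∂M = 0 := by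
  let E : Set T := {t | x t = y t}
  have hE : MeasurableSet E := measurableSet_eq_fun hx hy
  let a : T × T → ENNReal := fun p ↦
    ENNReal.ofReal (1 / (x p.1 - y p.1) - 1 / (y p.2 - y p.1))
  let b : T × T → ENNReal := fun p ↦
    ENNReal.ofReal (1 / (y p.2 - x p.2) - 1 / (y p.2 - y p.1))
  let c : T × T → ENNReal := fun p ↦ ENNReal.ofReal (1 / (y p.2 - y p.1))
  have ha : Measurable a := by fun_prop
  have hb : Measurable b := by fun_prop
  have hc : Measurable c := by fun_prop
  have hpos₁ : ∀ᵐ p ∂π, 0 < x p.1 - y p.1 :=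
    ae_pos_of_map_eq_withDensity (hx.sub hy) measurable_fst hπ₁
  have hpos₂ : ∀ᵐ p ∂π, 0 < y p.2 - x p.2 :=
    ae_pos_of_map_eq_withDensity (hy.sub hx) measurable_snd hπ₂
  have hac : a + c =ᵐ[π] fun p ↦ ENNReal.ofReal (1 / (x p.1 - y p.1)) := by
    filter_upwards [hpos₁, hxy] with p h1 h2
    simp only [Pi.add_apply, a, c]
    rw [← ENNReal.ofReal_add, sub_add_cancel]
    · exact sub_nonneg.2 (one_div_le_one_div_of_le h1 (by linarith))
    · exact one_div_nonneg.2 (by linarith)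
  have hbc : b + c =ᵐ[π] fun p ↦ ENNReal.ofReal (1 / (y p.2 - x p.2)) := by
    filter_upwards [hpos₂, hyx] with p h1 h2
    simp only [Pi.add_apply, b, c]
    rw [← ENNReal.ofReal_add, sub_add_cancel]
    · exact sub_nonneg.2 (one_div_le_one_div_of_le h1 (by linarith))
    · exact one_div_nonneg.2 (by linarith)
  have hsplit : μ.restrict E + (μ.restrict {t | 0 < x t - y t} +
      μ.restrict {t | 0 < y t - x t}) = μ := by
    have hne : {t | 0 < x t - y t} ∪ {t | 0 < y t - x t} = Eᶜ := by
      ext t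
      simp only [Set.mem_union, Set.mem_ofPred_eq, sub_pos, Set.mem_compl_iff, E]
      exact ⟨fun h e ↦ by rcases h with h | h <;> linarith, fun h ↦ (lt_or_gt_of_ne h).symm⟩
    have hneg : MeasurableSet {t | 0 < y t - x t} := measurableSet_lt measurable_const (hy.sub hx)
    rw [← Measure.restrict_union _ hneg, hne,
      Measure.restrict_add_restrict_compl hE]
    exact Set.disjoint_left.2 fun t h1 h2 ↦ by
      simp only [Set.mem_ofPred_eq] at h1 h2; linarith
  have hr₁ : (π.withDensity fun p ↦ ENNReal.ofReal (1 / (x p.1 - y p.1))).map Prod.fst =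
      μ.restrict {t | 0 < x t - y t} :=
    map_withDensity_one_div_eq_restrict (hx.sub hy) measurable_fst hπ₁
  have hr₂ : (π.withDensity fun p ↦ ENNReal.ofReal (1 / (y p.2 - x p.2))).map Prod.snd =
      μ.restrict {t | 0 < y t - x t} :=
    map_withDensity_one_div_eq_restrict (hy.sub hx) measurable_snd hπ₂
  have hmarg (z : T → ℝ) (hz : Measurable z) :
      (μ.restrict E).map z + ((π.withDensity a).map (fun p ↦ z p.1) +
        (π.withDensity c).map (fun p ↦ z p.1) + ((π.withDensity b).map (fun p ↦ z p.2) +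
        (π.withDensity c).map (fun p ↦ z p.2))) = μ.map z := by
    rw [← Measure.map_add _ _ (by fun_prop), ← Measure.map_add _ _ (by fun_prop),
      ← withDensity_add_left ha, ← withDensity_add_left hb, withDensity_congr_ae hac,
      withDensity_congr_ae hbc]
    change _ + (Measure.map (z ∘ Prod.fst) _ + Measure.map (z ∘ Prod.snd) _) = _
    rw [← Measure.map_map hz measurable_fst, ← Measure.map_map hz measurable_snd,
      hr₁, hr₂, ← Measure.map_add _ _ hz, ← Measure.map_add _ _ hz]
    exact congrArg (Measure.map z) hsplit
  let M : Measure (ℝ × ℝ) := (μ.restrict E).map (fun t ↦ (x t, y t)) +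
    ((π.withDensity a).map (fun p ↦ (x p.1, y p.1)) +
      (π.withDensity c).map (fun p ↦ (x p.1, y p.2)) +
      ((π.withDensity b).map (fun p ↦ (x p.2, y p.2)) +
      (π.withDensity c).map (fun p ↦ (x p.2, y p.1))))
  have hfst : M.map Prod.fst = μ.map x := by
    rw [← hmarg x hx]
    simp only [M]
    rw [Measure.map_add _ _ measurable_fst, Measure.map_add _ _ measurable_fst,
      Measure.map_add _ _ measurable_fst, Measure.map_add _ _ measurable_fst,
      Measure.map_map measurable_fst (by fun_prop), Measure.map_map measurable_fst (by fun_prop),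
      Measure.map_map measurable_fst (by fun_prop), Measure.map_map measurable_fst (by fun_prop),
      Measure.map_map measurable_fst (by fun_prop)]
    rfl
  have hsnd : M.map Prod.snd = μ.map y := by
    rw [← hmarg y hy]
    simp only [M]
    rw [Measure.map_add _ _ measurable_snd, Measure.map_add _ _ measurable_snd,
      Measure.map_add _ _ measurable_snd, Measure.map_add _ _ measurable_snd,
      Measure.map_map measurable_snd (by fun_prop), Measure.map_map measurable_snd (by fun_prop),
      Measure.map_map measurable_snd (by fun_prop), Measure.map_map measurable_snd (by fun_prop),
      Measure.map_map measurable_snd (by fun_prop)]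
    simp only [Function.comp_def]
    abel
  refine ⟨M, hfst, hsnd, fun s hs ↦ ?_⟩
  let h : ℝ × ℝ → ℝ := (Prod.fst ⁻¹' s).indicator fun p ↦ p.2 - p.1
  have hhm : Measurable h := (measurable_snd.sub measurable_fst).indicator (measurable_fst hs)
  have hind (u v : ℝ) : h (u, v) = s.indicator 1 u * (v - u) := by
    by_cases hu : u ∈ s <;> simp [h, hu]
  have hint : Integrable h M := by
    have h1 : Integrable (fun r : ℝ ↦ r) (M.map Prod.fst) := by
      rw [hfst]
      exact (integrable_map_measure aestronglyMeasurable_id hx.aemeasurable).2 hxi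
    have h2 : Integrable (fun r : ℝ ↦ r) (M.map Prod.snd) := by
      rw [hsnd]
      exact (integrable_map_measure aestronglyMeasurable_id hy.aemeasurable).2 hyi
    exact (((integrable_map_measure aestronglyMeasurable_id measurable_snd.aemeasurable).1 h2).sub
      ((integrable_map_measure aestronglyMeasurable_id measurable_fst.aemeasurable).1 h1)).indicator
        (measurable_fst hs)
  rw [← integral_indicator (measurable_fst hs)]
  change ∫ p, h p ∂M = 0
  obtain ⟨i0, i1234⟩ := integrable_add_measure.1 hint
  obtain ⟨i12, i34⟩ := integrable_add_measure.1 i1234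
  obtain ⟨i1, i2⟩ := integrable_add_measure.1 i12
  obtain ⟨i3, i4⟩ := integrable_add_measure.1 i34
  have hE0 : ∫ p, h p ∂(μ.restrict E).map (fun t ↦ (x t, y t)) = 0 := by
    rw [integral_map (by fun_prop) hhm.aestronglyMeasurable]
    refine setIntegral_eq_zero_of_forall_eq_zero fun t ht ↦ ?_
    simp [h, show x t = y t from ht]
  have hdens {w : T × T → ENNReal} (hw : Measurable w) (hwt : ∀ p, w p < ⊤)
      {φ : T × T → ℝ × ℝ} (hφ : Measurable φ) (hi : Integrable h ((π.withDensity w).map φ)) :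
      Integrable (fun p ↦ (w p).toReal * h (φ p)) π ∧
        ∫ p, h p ∂(π.withDensity w).map φ = ∫ p, (w p).toReal * h (φ p) ∂π := by
    rw [integrable_map_measure hhm.aestronglyMeasurable hφ.aemeasurable,
      integrable_withDensity_iff_integrable_smul' hw (.of_forall hwt)] at hi
    refine ⟨hi, ?_⟩
    rw [integral_map hφ.aemeasurable hhm.aestronglyMeasurable,
      integral_withDensity_eq_integral_toReal_smul hw (.of_forall hwt)]
    rfl
  have hat (p) : a p < ⊤ := ENNReal.ofReal_lt_top
  have hbt (p) : b p < ⊤ := ENNReal.ofReal_lt_top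
  have hct (p) : c p < ⊤ := ENNReal.ofReal_lt_top
  obtain ⟨j1, e1⟩ := hdens ha hat (by fun_prop) i1
  obtain ⟨j2, e2⟩ := hdens hc hct (by fun_prop) i2
  obtain ⟨j3, e3⟩ := hdens hb hbt (by fun_prop) i3
  obtain ⟨j4, e4⟩ := hdens hc hct (by fun_prop) i4
  have hswap₁ : ∫ p, (a p).toReal * h (x p.1, y p.1) ∂π +
      ∫ p, (c p).toReal * h (x p.1, y p.2) ∂π = 0 := by
    rw [← integral_add j1 j2]
    refine integral_eq_zero_of_ae ?_
    filter_upwards [hpos₁, hxy] with p h1 h2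
    have h3 : 0 < y p.2 - y p.1 := by linarith
    simp only [a, c, hind, Pi.zero_apply]
    rw [ENNReal.toReal_ofReal (sub_nonneg.2 (one_div_le_one_div_of_le h1 (by linarith))),
      ENNReal.toReal_ofReal (one_div_nonneg.2 h3.le)]
    field_simp
    ring
  have hswap₂ : ∫ p, (b p).toReal * h (x p.2, y p.2) ∂π +
      ∫ p, (c p).toReal * h (x p.2, y p.1) ∂π = 0 := by
    rw [← integral_add j3 j4]
    refine integral_eq_zero_of_ae ?_
    filter_upwards [hpos₂, hyx] with p h1 h2
    have h3 : 0 < y p.2 - y p.1 := by linarith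
    simp only [b, c, hind, Pi.zero_apply]
    rw [ENNReal.toReal_ofReal (sub_nonneg.2 (one_div_le_one_div_of_le h1 (by linarith))),
      ENNReal.toReal_ofReal (one_div_nonneg.2 h3.le)]
    field_simp
    ring
  rw [integral_add_measure i0 i1234, integral_add_measure i12 i34, integral_add_measure i1 i2,
    integral_add_measure i3 i4, hE0, e1, e2, e3, e4, hswap₁, hswap₂]
  simp

end Swap

section ConvexOrder

variable {T : Type*} [MeasurableSpace T] {μ ν : Measure ℝ} {d : T → ℝ}

lemma lintegral_ofReal_neg_le_iff {m : Measure T} (hd : Integrable d m) :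
    ∫⁻ t, ENNReal.ofReal (-d t) ∂m ≤ ∫⁻ t, ENNReal.ofReal (d t) ∂m ↔ 0 ≤ ∫ t, d t ∂m := by
  rw [integral_eq_lintegral_pos_part_sub_lintegral_neg_part hd, sub_nonneg]
  exact (ENNReal.toReal_le_toReal hd.neg.lintegral_lt_top.ne hd.lintegral_lt_top.ne).symm

lemma integrable_quantile [IsProbabilityMeasure μ] (hμ : Integrable (fun r ↦ r) μ) :
    Integrable (quantile μ) uniformIoo := by
  rw [← map_quantile_uniformIoo μ] at hμ
  exact (integrable_map_measure aestronglyMeasurable_id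
    (measurable_quantile μ).aemeasurable).1 hμ

lemma integral_comp_quantile [IsProbabilityMeasure μ] {f : ℝ → ℝ} (hf : Measurable f) :
    ∫ w, f (quantile μ w) ∂uniformIoo = ∫ r, f r ∂μ := by
  conv_rhs => rw [← map_quantile_uniformIoo μ]
  exact (integral_map (measurable_quantile μ).aemeasurable hf.aestronglyMeasurable).symm

lemma setIntegral_Iic_quantile_sub_nonneg [IsProbabilityMeasure μ] [IsProbabilityMeasure ν]
    (hμ : Integrable (fun r ↦ r) μ) (hν : Integrable (fun r ↦ r) ν)
    (hput : ∀ k, ∫ r, max (k - r) 0 ∂ν ≤ ∫ r, max (k - r) 0 ∂μ)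
    (hmean : ∫ r, r ∂μ = ∫ r, r ∂ν) (t : ℝ) :
    0 ≤ ∫ w in Set.Iic t, (quantile ν w - quantile μ w) ∂uniformIoo := by
  have hx := integrable_quantile hν
  have hy := integrable_quantile hμ
  rcases le_or_gt t 0 with ht0 | ht0
  · have h : ∀ᵐ w ∂uniformIoo, w ∉ Set.Iic t := by
      filter_upwards [ae_mem_Ioo_uniformIoo] with w hw h
      exact absurd (h.trans ht0) hw.1.not_ge
    rw [Measure.restrict_eq_zero.2 (measure_eq_zero_iff_ae_notMem.2 h), integral_zero_measure]
  rcases le_or_gt 1 t with ht1 | ht1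
  · have h : ∀ᵐ w ∂uniformIoo, w ∈ Set.Iic t := by
      filter_upwards [ae_mem_Ioo_uniformIoo] with w hw
      exact hw.2.le.trans ht1
    rw [Measure.restrict_eq_self_of_ae_mem h, integral_sub hx hy,
      integral_comp_quantile (f := fun r ↦ r) measurable_id,
      integral_comp_quantile (f := fun r ↦ r) measurable_id, hmean, sub_self]
  have ht : t ∈ Set.Ioo (0 : ℝ) 1 := ⟨ht0, ht1⟩
  set k := quantile μ t with hk
  have hkx : Integrable (fun w ↦ k - quantile ν w) uniformIoo := (integrable_const k).sub hx
  have hky : Integrable (fun w ↦ k - quantile μ w) uniformIoo := (integrable_const k).sub hy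
  have hY : ∫ r, max (k - r) 0 ∂μ = ∫ w in Set.Iic t, (k - quantile μ w) ∂uniformIoo := by
    rw [← integral_comp_quantile (f := fun r ↦ max (k - r) 0) (by fun_prop),
      ← integral_indicator measurableSet_Iic]
    refine integral_congr_ae ?_
    filter_upwards [ae_mem_Ioo_uniformIoo] with w hw
    rcases le_or_gt w t with h | h
    · rw [Set.indicator_of_mem (Set.mem_Iic.2 h)]
      exact max_eq_left (sub_nonneg.2 (monotoneOn_quantile μ hw ht h))
    · rw [Set.indicator_of_notMem (by simpa using h)]
      exact max_eq_right (sub_nonpos.2 (monotoneOn_quantile μ ht hw h.le))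
  have hX : ∫ w in Set.Iic t, (k - quantile ν w) ∂uniformIoo ≤ ∫ r, max (k - r) 0 ∂ν := by
    rw [← integral_comp_quantile (f := fun r ↦ max (k - r) 0) (by fun_prop)]
    have hpos : Integrable (fun w ↦ max (k - quantile ν w) 0) uniformIoo := hkx.pos_part
    exact (setIntegral_mono hkx.integrableOn hpos.integrableOn fun w ↦ le_max_left _ _).trans
      (setIntegral_le_integral hpos (.of_forall fun w ↦ le_max_right _ _))
  have hle := (hX.trans (hput k)).trans hY.le
  rw [← sub_nonneg, ← integral_sub hky.integrableOn hkx.integrableOn] at hle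
  simpa using hle

/-- Strassen's theorem on `ℝ`: laws in convex order are the marginals of a one-step martingale. -/
theorem exists_martingale_coupling [IsProbabilityMeasure μ] [IsProbabilityMeasure ν]
    (hμ : Integrable (fun r ↦ r) μ) (hν : Integrable (fun r ↦ r) ν)
    (hput : ∀ k, ∫ r, max (k - r) 0 ∂ν ≤ ∫ r, max (k - r) 0 ∂μ)
    (hmean : ∫ r, r ∂μ = ∫ r, r ∂ν) :
    ∃ M : Measure (ℝ × ℝ), M.map Prod.fst = ν ∧ M.map Prod.snd = μ ∧
      ∀ s, MeasurableSet s → ∫ p in Prod.fst ⁻¹' s, (p.2 - p.1) ∂M = 0 := by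
  have hxm := measurable_quantile ν
  have hym := measurable_quantile μ
  have hxi := integrable_quantile hν
  have hyi := integrable_quantile hμ
  set x := quantile ν with hxdef
  set y := quantile μ with hydef
  set α := uniformIoo.withDensity fun w ↦ ENNReal.ofReal (x w - y w) with hα
  set β := uniformIoo.withDensity fun w ↦ ENNReal.ofReal (y w - x w) with hβ
  have hαfin : IsFiniteMeasure α :=
    isFiniteMeasure_withDensity (hxi.sub hyi).lintegral_lt_top.ne
  have hβfin : IsFiniteMeasure β :=
    isFiniteMeasure_withDensity (hyi.sub hxi).lintegral_lt_top.ne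
  have hle (t : ℝ) : β (Set.Iic t) ≤ α (Set.Iic t) := by
    rw [hα, hβ, withDensity_apply _ measurableSet_Iic, withDensity_apply _ measurableSet_Iic]
    have h := (lintegral_ofReal_neg_le_iff (hxi.sub hyi).integrableOn).2
      (setIntegral_Iic_quantile_sub_nonneg hμ hν hput hmean t)
    simpa only [Pi.sub_apply, neg_sub] using h
  have hmean' : ∫ w, x w ∂uniformIoo = ∫ w, y w ∂uniformIoo := by
    rw [integral_comp_quantile (f := fun r ↦ r) measurable_id,
      integral_comp_quantile (f := fun r ↦ r) measurable_id, hmean]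
  have hmass : α Set.univ = β Set.univ := by
    rw [hα, hβ, withDensity_apply _ .univ, withDensity_apply _ .univ, Measure.restrict_univ]
    have h₁ := (lintegral_ofReal_neg_le_iff (hyi.sub hxi)).2
      (by simp [integral_sub hyi hxi, hmean'])
    have h₂ := (lintegral_ofReal_neg_le_iff (hxi.sub hyi)).2
      (by simp [integral_sub hxi hyi, hmean'])
    simp only [Pi.sub_apply, neg_sub] at h₁ h₂
    exact le_antisymm h₁ h₂
  obtain ⟨π, hπ₁, hπ₂, hπ⟩ := exists_coupling_le_of_measure_Iic_le α β hmass hle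
  have hI₁ : ∀ᵐ p ∂π, p.1 ∈ Set.Ioo (0 : ℝ) 1 :=
    ae_of_ae_map (p := fun w ↦ w ∈ Set.Ioo (0 : ℝ) 1) measurable_fst.aemeasurable
      (hπ₁ ▸ (withDensity_absolutelyContinuous _ _).ae_le ae_mem_Ioo_uniformIoo)
  have hI₂ : ∀ᵐ p ∂π, p.2 ∈ Set.Ioo (0 : ℝ) 1 :=
    ae_of_ae_map (p := fun w ↦ w ∈ Set.Ioo (0 : ℝ) 1) measurable_snd.aemeasurable
      (hπ₂ ▸ (withDensity_absolutelyContinuous _ _).ae_le ae_mem_Ioo_uniformIoo)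
  have hpos₁ : ∀ᵐ p ∂π, 0 < x p.1 - y p.1 :=
    ae_pos_of_map_eq_withDensity (hxm.sub hym) measurable_fst hπ₁
  have hpos₂ : ∀ᵐ p ∂π, 0 < y p.2 - x p.2 :=
    ae_pos_of_map_eq_withDensity (hym.sub hxm) measurable_snd hπ₂
  obtain ⟨M, hM₁, hM₂, hM⟩ := exists_martingale_coupling_of_transport uniformIoo hxm hym hxi hyi π
    hπ₁ hπ₂
    (by
      filter_upwards [hI₁, hI₂, hpos₂, hπ] with p h1 h2 h3 h4
      linarith [monotoneOn_quantile ν h1 h2 h4])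
    (by
      filter_upwards [hI₁, hI₂, hpos₁, hπ] with p h1 h2 h3 h4
      linarith [monotoneOn_quantile ν h1 h2 h4])
  exact ⟨M, hM₁.trans (map_quantile_uniformIoo ν), hM₂.trans (map_quantile_uniformIoo μ), hM⟩

lemma H0ViaBeliefOn_of_martingale_coupling [IsProbabilityMeasure ν]
    (hμ : Integrable (fun r ↦ r) μ) (hν : Integrable (fun r ↦ r) ν)
    {M : Measure (ℝ × ℝ)} (hM₁ : M.map Prod.fst = ν) (hM₂ : M.map Prod.snd = μ)
    (hM : ∀ s, MeasurableSet s → ∫ p in Prod.fst ⁻¹' s, (p.2 - p.1) ∂M = 0) :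
    H0ViaBeliefOn (ℝ × ℝ) M μ ν := by
  have hMprob : IsProbabilityMeasure M :=
    (Measure.isProbabilityMeasure_map_iff measurable_fst.aemeasurable).1
      (hM₁ ▸ inferInstance)
  have hfst : Integrable Prod.fst M := by
    rw [← hM₁] at hν
    exact (integrable_map_measure aestronglyMeasurable_id measurable_fst.aemeasurable).1 hν
  have hsnd : Integrable Prod.snd M := by
    rw [← hM₂] at hμ
    exact (integrable_map_measure aestronglyMeasurable_id measurable_snd.aemeasurable).1 hμ
  refine ⟨hMprob, Prod.snd, Prod.fst, measurable_snd, measurable_fst, hM₂, hM₁, ?_⟩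
  refine (ae_eq_condExp_of_forall_setIntegral_eq measurable_fst.comap_le hsnd
    (fun _ _ _ ↦ hfst.integrableOn) ?_
    (comap_measurable Prod.fst).stronglyMeasurable.aestronglyMeasurable).symm
  rintro _ ⟨s, hs, rfl⟩ -
  have h := hM s hs
  rw [integral_sub hsnd.integrableOn hfst.integrableOn, sub_eq_zero] at h
  exact h.symm

end ConvexOrder

lemma H0_of_H0ViaBeliefOn {Ω : Type} [mΩ : MeasurableSpace Ω] {P : Measure Ω} {μ ν : Measure ℝ}
    (h : H0ViaBeliefOn Ω P μ ν) : H0 μ ν := by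
  obtain ⟨hP, Y', ψ', hY, hψ, hYμ, hψν, hc⟩ := h
  exact ⟨Ω, mΩ, P, hP, Y', ψ', hY, hψ, hYμ, hψν, _, hψ.comap_le, le_rfl, hc⟩

lemma moment_conditions_of_H0 {μ ν : Measure ℝ} (hμ : Integrable (fun r ↦ r) μ)
    (h : H0 μ ν) :
    (∀ k, ∫ r, max (k - r) 0 ∂ν ≤ ∫ r, max (k - r) 0 ∂μ) ∧ ∫ r, r ∂μ = ∫ r, r ∂ν := by
  obtain ⟨Ω, mΩ, P, hP, Y', ψ', hY, hψ, rfl, rfl, m, hm, hψm, hc⟩ := h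
  have hYi : Integrable Y' P :=
    (integrable_map_measure aestronglyMeasurable_id hY.aemeasurable).1 hμ
  have hψi : Integrable ψ' P := integrable_condExp.congr hc
  refine ⟨fun k ↦ ?_, ?_⟩
  · rw [integral_map hψ.aemeasurable (by fun_prop), integral_map hY.aemeasurable (by fun_prop)]
    have hs : MeasurableSet[m] (ψ' ⁻¹' Set.Iio k) := hψm _ ⟨_, measurableSet_Iio, rfl⟩
    have hset : ∫ ω in ψ' ⁻¹' Set.Iio k, ψ' ω ∂P = ∫ ω in ψ' ⁻¹' Set.Iio k, Y' ω ∂P := by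
      rw [← setIntegral_condExp hm hYi hs]
      exact integral_congr_ae (ae_restrict_of_ae hc.symm)
    have hkY : Integrable (fun ω ↦ k - Y' ω) P := (integrable_const k).sub hYi
    have hpos : Integrable (fun ω ↦ max (k - Y' ω) 0) P := hkY.pos_part
    calc ∫ ω, max (k - ψ' ω) 0 ∂P = ∫ ω in ψ' ⁻¹' Set.Iio k, (k - ψ' ω) ∂P := by
          rw [← integral_indicator (hm _ hs)]
          congr 1
          ext ω
          by_cases h : ψ' ω < k
          · simp [h, h.le]
          · simp [h, not_lt.1 h]
      _ = ∫ ω in ψ' ⁻¹' Set.Iio k, (k - Y' ω) ∂P := by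
          rw [integral_sub (integrable_const k) hψi.integrableOn,
            integral_sub (integrable_const k) hYi.integrableOn, hset]
      _ ≤ ∫ ω in ψ' ⁻¹' Set.Iio k, max (k - Y' ω) 0 ∂P :=
          setIntegral_mono hkY.integrableOn hpos.integrableOn fun ω ↦ le_max_left _ _
      _ ≤ ∫ ω, max (k - Y' ω) 0 ∂P :=
          setIntegral_le_integral hpos (.of_forall fun ω ↦ le_max_right _ _)
  · rw [integral_map hψ.aemeasurable (by fun_prop), integral_map hY.aemeasurable (by fun_prop),
      ← integral_congr_ae hc, integral_condExp hm]

/-- Theorem 1 (i) ⇔ (iii) of the paper: H₀ holds iff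
`E[(y - Y)⁺] - E[(y - ψ)⁺] ≥ 0` for all `y ∈ ℝ` and `E[Y] = E[ψ]`; in particular, a coupling
`(Y', ψ')` with the same marginals and `E[Y' | σ(ψ')] = ψ'` a.s. exists iff these moment
inequalities and the moment equality hold. -/
theorem H0_iff_moment_conditions
    {Ω₁ Ω₂ : Type} [MeasurableSpace Ω₁] [MeasurableSpace Ω₂]
    (P₁ : Measure Ω₁) (P₂ : Measure Ω₂)
    [IsProbabilityMeasure P₁] [IsProbabilityMeasure P₂]
    {Y : Ω₁ → ℝ} {ψ : Ω₂ → ℝ}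
    (hYm : Measurable Y) (hψm : Measurable ψ)
    (hYi : Integrable Y P₁) (hψi : Integrable ψ P₂) :
    (H0 (P₁.map Y) (P₂.map ψ) ↔
      ((∀ y : ℝ, ∫ ω, max (y - ψ ω) 0 ∂P₂ ≤ ∫ ω, max (y - Y ω) 0 ∂P₁) ∧
        ∫ ω, Y ω ∂P₁ = ∫ ω, ψ ω ∂P₂)) ∧
    ((∃ (Ω : Type) (mΩ : MeasurableSpace Ω) (P : @Measure Ω mΩ),
        @H0ViaBeliefOn Ω mΩ P (P₁.map Y) (P₂.map ψ)) ↔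
      ((∀ y : ℝ, ∫ ω, max (y - ψ ω) 0 ∂P₂ ≤ ∫ ω, max (y - Y ω) 0 ∂P₁) ∧
        ∫ ω, Y ω ∂P₁ = ∫ ω, ψ ω ∂P₂)) := by
  have hμ : Integrable (fun r ↦ r) (P₁.map Y) :=
    (integrable_map_measure aestronglyMeasurable_id hYm.aemeasurable).2 hYi
  have hν : Integrable (fun r ↦ r) (P₂.map ψ) :=
    (integrable_map_measure aestronglyMeasurable_id hψm.aemeasurable).2 hψi
  have hμprob : IsProbabilityMeasure (P₁.map Y) :=
    Measure.isProbabilityMeasure_map hYm.aemeasurable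
  have hνprob : IsProbabilityMeasure (P₂.map ψ) :=
    Measure.isProbabilityMeasure_map hψm.aemeasurable
  have hputY (k : ℝ) : ∫ r, max (k - r) 0 ∂P₁.map Y = ∫ ω, max (k - Y ω) 0 ∂P₁ :=
    integral_map hYm.aemeasurable (by fun_prop)
  have hputψ (k : ℝ) : ∫ r, max (k - r) 0 ∂P₂.map ψ = ∫ ω, max (k - ψ ω) 0 ∂P₂ :=
    integral_map hψm.aemeasurable (by fun_prop)
  have hmeanY : ∫ r, r ∂P₁.map Y = ∫ ω, Y ω ∂P₁ := integral_map hYm.aemeasurable (by fun_prop)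
  have hmeanψ : ∫ r, r ∂P₂.map ψ = ∫ ω, ψ ω ∂P₂ := integral_map hψm.aemeasurable (by fun_prop)
  have hbelief (h : (∀ y : ℝ, ∫ ω, max (y - ψ ω) 0 ∂P₂ ≤ ∫ ω, max (y - Y ω) 0 ∂P₁) ∧
      ∫ ω, Y ω ∂P₁ = ∫ ω, ψ ω ∂P₂) :
      ∃ M : Measure (ℝ × ℝ), H0ViaBeliefOn (ℝ × ℝ) M (P₁.map Y) (P₂.map ψ) := by
    simp only [← hputY, ← hputψ, ← hmeanY, ← hmeanψ] at h
    obtain ⟨M, hM₁, hM₂, hM⟩ := exists_martingale_coupling hμ hν h.1 h.2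
    exact ⟨M, H0ViaBeliefOn_of_martingale_coupling hμ hν hM₁ hM₂ hM⟩
  have hmoments (h : H0 (P₁.map Y) (P₂.map ψ)) :
      (∀ y : ℝ, ∫ ω, max (y - ψ ω) 0 ∂P₂ ≤ ∫ ω, max (y - Y ω) 0 ∂P₁) ∧
        ∫ ω, Y ω ∂P₁ = ∫ ω, ψ ω ∂P₂ := by
    simpa only [hputY, hputψ, hmeanY, hmeanψ] using moment_conditions_of_H0 hμ h
  refine ⟨⟨hmoments, fun h ↦ ?_⟩, ⟨fun ⟨_, _, _, h⟩ ↦ hmoments (H0_of_H0ViaBeliefOn h),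
    fun h ↦ ?_⟩⟩
  · obtain ⟨M, hM⟩ := hbelief h
    exact H0_of_H0ViaBeliefOn hM
  · obtain ⟨M, hM⟩ := hbelief h
    exact ⟨ℝ × ℝ, _, M, hM⟩
end
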